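/- Consider scalings K_n, P_n, α_n such that α_n(1 − q(θ_n)) = (log n + γ_n)/n for all n, for some real sequence γ_n. Let I_n(θ_n, α_n) denote the number of isolated nodes in the random graph K∩G(n; θ_n, α_n). Then lim_{n→∞} E[I_n(θ_n, α_n)] = ∞ if lim_{n→∞} γ_n = −∞, and lim_{n→∞} E[I_n(θ_n, α_n)] = 0 if lim_{n→∞} γ_n = ∞. -/

import Mathlib

open Filter Finset

noncomputable section

/-- Key rings: `K`-element subsets of a pool `{1,…,P}` of keys. -/
abbrev KeyRing (P K : ℕ) : Type := {S : Finset (Fin P) // S.card = K}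

/-- Unordered node pairs, represented as ordered pairs `(i,j)` with `i < j`. -/
abbrev Pairs (n : ℕ) : Type := {e : Fin n × Fin n // e.1 < e.2}

/-- The number `C(P,K)` of possible key rings. -/
def numKR (P K : ℕ) : ℝ := (P.choose K : ℝ)

/-- Probability weight of a configuration `(κ, b)` under the product of the uniform
distribution on key rings (i.i.d. over the `n` nodes) and i.i.d. Bernoulli(α)
on/off link variables (one per unordered pair of nodes). -/
def wt (n P K : ℕ) (α : ℝ) (κ : Fin n → KeyRing P K) (b : Pairs n → Bool) : ℝ :=
  (numKR P K)⁻¹ ^ n * ∏ e : Pairs n, (if b e then α else 1 - α)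

/-- The on/off state of the channel between nodes `i` and `j`. -/
def link {n : ℕ} (b : Pairs n → Bool) (i j : Fin n) : Bool :=
  if h : i < j then b ⟨(i, j), h⟩
  else if h' : j < i then b ⟨(j, i), h'⟩
  else false

/-- Adjacency in the intersection graph `K ∩ G(n; θ, α)`:  the key rings of `i` and `j`
intersect and the channel between them is on. -/
abbrev Adj {n P K : ℕ} (κ : Fin n → KeyRing P K) (b : Pairs n → Bool) (i j : Fin n) : Prop :=
  i ≠ j ∧ ((κ i).1 ∩ (κ j).1).Nonempty ∧ link b i j = true

/-- Node `i` is isolated: it is adjacent to no other node. -/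
abbrev Isolated {n P K : ℕ} (κ : Fin n → KeyRing P K) (b : Pairs n → Bool) (i : Fin n) : Prop :=
  ∀ j, ¬ Adj κ b i j

/-- `P_n(θ,α)`: probability that `K ∩ G(n; θ, α)` contains no isolated nodes. -/
def probNoIsolated (n P K : ℕ) (α : ℝ) : ℝ :=
  ∑ κ : Fin n → KeyRing P K, ∑ b : Pairs n → Bool,
    wt n P K α κ b * (if ∀ i, ¬ Isolated κ b i then 1 else 0)

/-- Number of isolated nodes in the configuration `(κ, b)`. -/
def numIsolated {n P K : ℕ} (κ : Fin n → KeyRing P K) (b : Pairs n → Bool) : ℕ :=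
  (Finset.univ.filter fun i => Isolated κ b i).card

/-- `E[I_n(θ,α)]`: expected number of isolated nodes in `K ∩ G(n; θ, α)`. -/
def expIsolated (n P K : ℕ) (α : ℝ) : ℝ :=
  ∑ κ : Fin n → KeyRing P K, ∑ b : Pairs n → Bool,
    wt n P K α κ b * (numIsolated κ b : ℝ)

/-- `q(θ) = C(P−K,K)/C(P,K)` if `2K ≤ P`, and `0` otherwise. -/
def q (K P : ℕ) : ℝ :=
  if 2 * K ≤ P then ((P - K).choose K : ℝ) / (P.choose K : ℝ) else 0

/-- `v(θ;r) = C(P−r,K)/C(P,K)` if `r ≤ P−K`, and `0` otherwise. -/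
def v (K P r : ℕ) : ℝ :=
  if r ≤ P - K then ((P - r).choose K : ℝ) / (P.choose K : ℝ) else 0

end

theorem q_eq (K P : ℕ) : q K P = ((P - K).choose K : ℝ) / (P.choose K : ℝ) := by
  unfold q
  split_ifs with h
  · rfl
  · rw [Nat.choose_eq_zero_of_lt (by omega)]; simp

theorem card_keyRing (P K : ℕ) : Fintype.card (KeyRing P K) = P.choose K := by
  rw [Fintype.card_finset_len, Fintype.card_fin]

theorem card_disj (P K : ℕ) (S : KeyRing P K) :
    (univ.filter fun T : KeyRing P K => ¬ (S.1 ∩ T.1).Nonempty).card = (P - K).choose K := by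
  have h1 : (powersetCard K (S.1)ᶜ).card = (P - K).choose K := by
    rw [card_powersetCard, card_compl, S.2, Fintype.card_fin]
  rw [← h1]
  refine Finset.card_bij (fun T _ => T.1) ?_ ?_ ?_
  · intro T hT
    simp only [mem_filter, mem_univ, true_and, not_nonempty_iff_eq_empty] at hT
    rw [mem_powersetCard]
    refine ⟨?_, T.2⟩
    intro x hx
    rw [mem_compl]
    intro hx'
    have : x ∈ S.1 ∩ T.1 := mem_inter.2 ⟨hx', hx⟩
    rw [hT] at this
    simp at this
  · intro T _ T' _ h
    exact Subtype.ext h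
  · intro T hT
    rw [mem_powersetCard] at hT
    refine ⟨⟨T, hT.2⟩, ?_, rfl⟩
    simp only [mem_filter, mem_univ, true_and, not_nonempty_iff_eq_empty]
    ext x
    simp only [mem_inter, notMem_empty, iff_false, not_and]
    intro hx hx'
    exact (mem_compl.1 (hT.1 hx')) hx

theorem sum_ring (P K : ℕ) (hKP : K < P) (α : ℝ) (S : KeyRing P K) :
    ∑ T : KeyRing P K, (if (S.1 ∩ T.1).Nonempty then 1 - α else 1)
      = (P.choose K : ℝ) * (1 - α * (1 - q K P)) := by
  have hC : (P.choose K : ℝ) ≠ 0 := by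
    exact_mod_cast (Nat.choose_pos hKP.le).ne'
  have h1 : ∀ T : KeyRing P K, (if (S.1 ∩ T.1).Nonempty then 1 - α else 1)
      = (1 - α) + α * (if ¬ (S.1 ∩ T.1).Nonempty then 1 else 0) := by
    intro T
    by_cases h : (S.1 ∩ T.1).Nonempty <;> simp [h]
  rw [Finset.sum_congr rfl fun T _ => h1 T, sum_add_distrib, ← mul_sum, sum_boole, card_disj,
    sum_const, card_univ, card_keyRing, q_eq, nsmul_eq_mul]
  field_simp
  ring

theorem sum_rings (n P K : ℕ) (hKP : K < P) (α : ℝ) (i : Fin n) :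
    ∑ κ : Fin n → KeyRing P K,
      ∏ j ∈ univ.erase i, (if ((κ i).1 ∩ (κ j).1).Nonempty then 1 - α else 1)
      = (P.choose K : ℝ) ^ n * (1 - α * (1 - q K P)) ^ (n - 1) := by
  have h1 : ∀ κ : Fin n → KeyRing P K,
      ∏ j ∈ univ.erase i, (if ((κ i).1 ∩ (κ j).1).Nonempty then 1 - α else 1)
      = ∑ S : KeyRing P K, ∏ j, (if j = i then (if κ j = S then 1 else 0) else
          (if (S.1 ∩ (κ j).1).Nonempty then 1 - α else 1)) := by
    intro κ
    rw [Finset.sum_eq_single (κ i)]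
    · rw [← Finset.mul_prod_erase univ _ (mem_univ i)]
      simp only [if_true, one_mul]
      refine Finset.prod_congr rfl fun j hj => ?_
      rw [if_neg (ne_of_mem_erase hj)]
    · intro S _ hS
      refine Finset.prod_eq_zero (mem_univ i) ?_
      simp [hS.symm]
    · simp
  rw [Finset.sum_congr rfl fun κ _ => h1 κ, Finset.sum_comm]
  have h2 : ∀ S : KeyRing P K, ∑ κ : Fin n → KeyRing P K,
      ∏ j, (if j = i then (if κ j = S then 1 else 0) else
          (if (S.1 ∩ (κ j).1).Nonempty then 1 - α else 1))
      = ((P.choose K : ℝ) * (1 - α * (1 - q K P))) ^ (n - 1) := by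
    intro S
    have := Finset.prod_univ_sum (fun _ : Fin n => (univ : Finset (KeyRing P K)))
      (fun j T => (if j = i then (if T = S then (1 : ℝ) else 0) else
          (if (S.1 ∩ T.1).Nonempty then 1 - α else 1)))
    rw [Fintype.piFinset_univ] at this
    rw [← this, ← Finset.mul_prod_erase univ _ (mem_univ i)]
    simp only [if_true, Finset.sum_ite_eq', mem_univ, one_mul]
    rw [Finset.prod_congr rfl (g := fun _ => (P.choose K : ℝ) * (1 - α * (1 - q K P)))]
    · rw [prod_const, card_erase_of_mem (mem_univ i), card_univ, Fintype.card_fin]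
    · intro j hj
      simp only [if_neg (ne_of_mem_erase hj)]
      exact sum_ring P K hKP α S
  rw [Finset.sum_congr rfl fun S _ => h2 S, sum_const, card_univ, card_keyRing, nsmul_eq_mul,
    mul_pow, ← mul_assoc, ← pow_succ', Nat.sub_add_cancel (by have := i.2; omega)]

theorem isolated_iff {n P K : ℕ} (κ : Fin n → KeyRing P K) (b : Pairs n → Bool) (i : Fin n) :
    Isolated κ b i ↔ ∀ e : Pairs n,
      ¬ ((e.1.1 = i ∨ e.1.2 = i) ∧ ((κ e.1.1).1 ∩ (κ e.1.2).1).Nonempty ∧ b e = true) := by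
  constructor
  · rintro h ⟨⟨a, c⟩, hac⟩ ⟨h1, h2, h3⟩
    simp only at h1 h2 hac
    rcases h1 with h1 | h1
    · subst h1
      exact h c ⟨hac.ne, h2, by simp [link, hac, h3]⟩
    · subst h1
      refine h a ⟨hac.ne', by rwa [inter_comm], by simp [link, hac, hac.not_gt, h3]⟩
  · rintro h j ⟨h1, h2, h3⟩
    unfold link at h3
    split_ifs at h3 with h4 h5
    · exact h ⟨(i, j), h4⟩ ⟨Or.inl rfl, h2, h3⟩
    · exact h ⟨(j, i), h5⟩ ⟨Or.inr rfl, by simpa only [inter_comm] using h2, h3⟩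

theorem sum_links (n P K : ℕ) (α : ℝ) (κ : Fin n → KeyRing P K) (i : Fin n) :
    ∑ b : Pairs n → Bool, (∏ e : Pairs n, (if b e then α else 1 - α)) *
        (if Isolated κ b i then 1 else 0)
      = ∏ j ∈ univ.erase i, (if ((κ i).1 ∩ (κ j).1).Nonempty then 1 - α else 1) := by
  have h1 : ∀ b : Pairs n → Bool, (∏ e : Pairs n, (if b e then α else 1 - α)) *
        (if Isolated κ b i then 1 else 0)
      = ∏ e : Pairs n, ((if b e then α else 1 - α) *
        (if ¬ ((e.1.1 = i ∨ e.1.2 = i) ∧ ((κ e.1.1).1 ∩ (κ e.1.2).1).Nonempty ∧ b e = true)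
          then 1 else 0)) := by
    intro b
    rw [Finset.prod_mul_distrib, Finset.prod_boole]
    congr 1
    simp only [isolated_iff, mem_univ, true_implies]
  rw [Finset.sum_congr rfl fun b _ => h1 b]
  have := Finset.prod_univ_sum (fun _ : Pairs n => (univ : Finset Bool))
      (fun e c => ((if c then α else 1 - α) *
        (if ¬ ((e.1.1 = i ∨ e.1.2 = i) ∧ ((κ e.1.1).1 ∩ (κ e.1.2).1).Nonempty ∧ c = true)
          then (1 : ℝ) else 0)))
  rw [Fintype.piFinset_univ] at this
  rw [← this]
  have h2 : ∀ e : Pairs n, ∑ c : Bool, ((if c then α else 1 - α) *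
        (if ¬ ((e.1.1 = i ∨ e.1.2 = i) ∧ ((κ e.1.1).1 ∩ (κ e.1.2).1).Nonempty ∧ c = true)
          then (1 : ℝ) else 0)) = if (e.1.1 = i ∨ e.1.2 = i) then
            (if ((κ e.1.1).1 ∩ (κ e.1.2).1).Nonempty then 1 - α else 1) else 1 := by
    intro e
    by_cases ha : (e.1.1 = i ∨ e.1.2 = i) <;>
    by_cases hb : ((κ e.1.1).1 ∩ (κ e.1.2).1).Nonempty <;> simp [ha, hb]
  rw [Finset.prod_congr rfl fun e _ => h2 e, ← Finset.prod_filter]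
  refine Finset.prod_bij (fun e _ => if e.1.1 = i then e.1.2 else e.1.1) ?_ ?_ ?_ ?_
  · rintro ⟨⟨a, c⟩, hac⟩ he
    simp only [mem_filter, mem_univ, true_and] at he hac
    rw [mem_erase]
    refine ⟨?_, mem_univ _⟩
    simp only
    split_ifs with h
    · subst h; exact hac.ne'
    · exact h
  · rintro ⟨⟨a, c⟩, hac⟩ he ⟨⟨a', c'⟩, hac'⟩ he' h
    simp only [mem_filter, mem_univ, true_and] at he hac he' hac' h
    simp only [Subtype.mk.injEq, Prod.mk.injEq]
    split_ifs at h <;> grind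
  · intro j hj
    have hj := ne_of_mem_erase hj
    rcases lt_or_gt_of_ne hj with h | h
    · exact ⟨⟨(j, i), h⟩, by simp, by simp [hj]⟩
    · exact ⟨⟨(i, j), h⟩, by simp, by simp⟩
  · rintro ⟨⟨a, c⟩, hac⟩ he
    simp only [mem_filter, mem_univ, true_and] at he hac
    simp only
    by_cases h : a = i
    · subst h; simp
    · have : c = i := by tauto
      subst this
      simp only [if_neg h, inter_comm]

theorem expIsolated_eq (n P K : ℕ) (hKP : K < P) (α : ℝ) :
    expIsolated n P K α = n * (1 - α * (1 - q K P)) ^ (n - 1) := by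
  have hC : (P.choose K : ℝ) ≠ 0 := by
    exact_mod_cast (Nat.choose_pos hKP.le).ne'
  unfold expIsolated
  have h1 : ∀ κ : Fin n → KeyRing P K, ∑ b : Pairs n → Bool,
      wt n P K α κ b * (numIsolated κ b : ℝ)
      = (P.choose K : ℝ)⁻¹ ^ n * ∑ i : Fin n, ∏ j ∈ univ.erase i,
        (if ((κ i).1 ∩ (κ j).1).Nonempty then 1 - α else 1) := by
    intro κ
    rw [← Finset.sum_congr rfl fun i _ => sum_links n P K α κ i, Finset.sum_comm, Finset.mul_sum]
    refine Finset.sum_congr rfl fun b _ => ?_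
    rw [← Finset.mul_sum, Finset.sum_boole, ← mul_assoc]
    rfl
  rw [Finset.sum_congr rfl fun κ _ => h1 κ, ← Finset.mul_sum, Finset.sum_comm,
    Finset.sum_congr rfl fun i _ => sum_rings n P K hKP α i, sum_const, card_univ,
    Fintype.card_fin, nsmul_eq_mul, inv_pow]
  field_simp

theorem q_bounds (K P : ℕ) : 0 ≤ q K P ∧ q K P ≤ 1 := by
  rw [q_eq]
  refine ⟨by positivity, div_le_one_of_le₀ ?_ (by positivity)⟩
  exact_mod_cast Nat.choose_le_choose K (Nat.sub_le P K)

theorem upper_bd (n : ℕ) (hn : 1 ≤ n) (x g : ℝ) (hx1 : x ≤ 1)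
    (hx : x = (Real.log n + g) / n) :
    n * (1 - x) ^ (n - 1) ≤ Real.exp (1 - g) := by
  have hn0 : (0 : ℝ) < n := by exact_mod_cast hn
  have hnx : n * x = Real.log n + g := by rw [hx]; field_simp
  have h1 : (1 - x) ^ (n - 1) ≤ Real.exp (-x) ^ (n - 1) :=
    pow_le_pow_left₀ (by linarith) (by have := Real.add_one_le_exp (-x); linarith) _
  rw [← Real.exp_nat_mul, Nat.cast_sub hn] at h1
  calc n * (1 - x) ^ (n - 1) ≤ n * Real.exp (((n : ℝ) - (1 : ℕ)) * -x) := by gcongr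
    _ = Real.exp (Real.log n + ((n : ℝ) - (1 : ℕ)) * -x) := by rw [Real.exp_add, Real.exp_log hn0]
    _ ≤ Real.exp (1 - g) := by
      apply Real.exp_le_exp.2
      push_cast
      nlinarith

theorem lower_bd (n : ℕ) (hn : 1 ≤ n) (x g : ℝ) (hx0 : 0 ≤ x) (hg : g ≤ 0)
    (hx : x = (Real.log n + g) / n) :
    Real.exp (-g - 8) ≤ n * (1 - x) ^ (n - 1) := by
  have hn0 : (0 : ℝ) < n := by exact_mod_cast hn
  have hnx : n * x = Real.log n + g := by rw [hx]; field_simp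
  obtain ⟨s, hs0, hs⟩ : ∃ s : ℝ, 0 < s ∧ (n : ℝ) = s ^ 2 :=
    ⟨Real.sqrt n, Real.sqrt_pos.2 hn0, (Real.sq_sqrt hn0.le).symm⟩
  have hlog : Real.log n ≤ 2 * (s - 1) := by
    rw [hs, Real.log_pow]
    have := Real.log_le_sub_one_of_pos hs0
    push_cast
    linarith
  have hle : n * x ≤ 2 * (s - 1) := by linarith
  have hsx : s * x ≤ 2 := by
    have : s * (s * x) ≤ s * 2 := by
      rw [hs] at hle; nlinarith
    exact le_of_mul_le_mul_left this hs0
  have hhalf : x ≤ 1 / 2 := by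
    have : n * x ≤ n * (1 / 2) := by
      rw [hs] at hle ⊢; nlinarith [sq_nonneg (s - 2)]
    exact le_of_mul_le_mul_left this hn0
  have hx2 : n * x ^ 2 ≤ 4 := by
    have : n * x ^ 2 = (s * x) ^ 2 := by rw [hs]; ring
    rw [this]
    nlinarith [mul_nonneg hs0.le hx0]
  have hpos : 0 < 1 - x := by linarith
  have hexp : Real.exp (-(x + 2 * x ^ 2)) ≤ 1 - x := by
    rw [← Real.le_log_iff_exp_le hpos]
    have h := Real.one_sub_inv_le_log_of_pos hpos
    have h3 : (1 - x)⁻¹ ≤ 1 + x + 2 * x ^ 2 := by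
      rw [inv_le_iff_one_le_mul₀ hpos]
      nlinarith [mul_nonneg (sq_nonneg x) (by linarith : 0 ≤ 1 - 2 * x)]
    linarith
  calc Real.exp (-g - 8) ≤ Real.exp (Real.log n + n * (-(x + 2 * x ^ 2))) := by
        apply Real.exp_le_exp.2
        nlinarith
    _ = n * Real.exp (-(x + 2 * x ^ 2)) ^ n := by
        rw [Real.exp_add, Real.exp_log hn0, Real.exp_nat_mul]
    _ ≤ n * (1 - x) ^ n := by gcongr
    _ ≤ n * (1 - x) ^ (n - 1) := by
        gcongr n * ?_
        exact pow_le_pow_of_le_one hpos.le (by linarith) (Nat.sub_le n 1)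

/-- Lemma 1 (zero-infinity law for the first moment): if
`α_n (1 - q(θ_n)) = (log n + γ_n)/n`, then `E[I_n(θ_n,α_n)] → ∞` when `γ_n → -∞`
and `E[I_n(θ_n,α_n)] → 0` when `γ_n → ∞`. -/
theorem firstMoment_zeroInfinityLaw
    (K P : ℕ → ℕ) (α γ : ℕ → ℝ)
    (hK : ∀ n, 0 < K n) (hKP : ∀ n, K n < P n)
    (hα : ∀ n, 0 ≤ α n ∧ α n ≤ 1)
    (hscal : ∀ n, 1 ≤ n → α n * (1 - q (K n) (P n)) = (Real.log n + γ n) / n) :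
    (Tendsto γ atTop atBot →
      Tendsto (fun n => expIsolated n (P n) (K n) (α n)) atTop atTop) ∧
    (Tendsto γ atTop atTop →
      Tendsto (fun n => expIsolated n (P n) (K n) (α n)) atTop (nhds 0)) := by
  have hx0 : ∀ n, 0 ≤ α n * (1 - q (K n) (P n)) := fun n =>
    mul_nonneg (hα n).1 (by linarith [(q_bounds (K n) (P n)).2])
  have hx1 : ∀ n, α n * (1 - q (K n) (P n)) ≤ 1 := fun n =>
    mul_le_one₀ (hα n).2 (by linarith [(q_bounds (K n) (P n)).2])
      (by linarith [(q_bounds (K n) (P n)).1])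
  constructor
  · intro hγ
    have ht : Tendsto (fun n => Real.exp (-γ n - 8)) atTop atTop :=
      Real.tendsto_exp_atTop.comp
        (tendsto_atTop_add_const_right _ (-8) (tendsto_neg_atBot_atTop.comp hγ))
    refine tendsto_atTop_mono' _ ?_ ht
    filter_upwards [hγ.eventually_le_atBot 0, eventually_ge_atTop 1] with n hg hn
    rw [expIsolated_eq _ _ _ (hKP n)]
    exact lower_bd n hn _ _ (hx0 n) hg (hscal n hn)
  · intro hγ
    have ht : Tendsto (fun n => Real.exp (1 - γ n)) atTop (nhds 0) :=
      Real.tendsto_exp_atBot.comp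
        (tendsto_atBot_add_const_left _ 1 (tendsto_neg_atTop_atBot.comp hγ))
    refine tendsto_of_tendsto_of_tendsto_of_le_of_le' tendsto_const_nhds ht ?_ ?_
    · filter_upwards with n
      rw [expIsolated_eq _ _ _ (hKP n)]
      have := hx1 n
      exact mul_nonneg (Nat.cast_nonneg n) (pow_nonneg (by linarith) _)
    · filter_upwards [eventually_ge_atTop 1] with n hn
      rw [expIsolated_eq _ _ _ (hKP n)]
      exact upper_bd n hn _ _ (hx1 n) (hscal n hn)
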